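/- For integers d ≥ 3 and L ≥ 0, let λ_min(d,L) denote the smallest eigenvalue of the Dirichlet Laplacian 𝓛_D of the finite d-regular tree of depth L+1. Then λ_min(d,L) converges to 1 − (2/d)·√(d−1) (the spectral gap of the infinite d-regular tree) as L → ∞. -/

import Mathlib

open scoped Classical

/-- Vertices of the finite (truncated) `d`-regular tree whose leaves are at depth `R`:
a vertex at depth `n ≤ R` is encoded by its depth together with its path from the root,
with an entry in `Fin d` at step `0` (the root has `d` children) and entries `< d − 1`
at steps `1, …, n−1` (each deeper non-leaf vertex has `d − 1` children, hence degree `d`);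
entries at steps `≥ n` are padded by `0`. -/
abbrev TreeVertex (d R : ℕ) : Type :=
  { p : Fin (R + 1) × (Fin R → Fin d) //
      (∀ i : Fin R, p.1.1 ≤ i.1 → (p.2 i : ℕ) = 0) ∧
      (∀ i : Fin R, 0 < i.1 → i.1 < p.1.1 → (p.2 i : ℕ) < d - 1) }

namespace TreeVertex

/-- The depth of a vertex. -/
def depth {d R : ℕ} (v : TreeVertex d R) : ℕ := v.1.1.1

/-- `ChildOf u v` means `v` is a child of `u`. -/
def ChildOf {d R : ℕ} (u v : TreeVertex d R) : Prop :=
  v.depth = u.depth + 1 ∧ ∀ i : Fin R, i.1 < u.depth → v.1.2 i = u.1.2 i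

/-- `Desc u v` means `v` is a descendant of `u` (including `u` itself). -/
def Desc {d R : ℕ} (u v : TreeVertex d R) : Prop :=
  u.depth ≤ v.depth ∧ ∀ i : Fin R, i.1 < u.depth → v.1.2 i = u.1.2 i

/-- The root of the tree (for `d > 0`). -/
def root (d R : ℕ) (hd : 0 < d) : TreeVertex d R :=
  ⟨(0, fun _ => ⟨0, hd⟩), fun _ _ => rfl, fun i _ h => absurd h (by simp)⟩

/-- Two vertices are adjacent iff one is a child of the other. -/
def Adj {d R : ℕ} (u v : TreeVertex d R) : Prop := ChildOf u v ∨ ChildOf v u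

/-- The interior vertices: those of depth `< R`, i.e. the non-leaves. -/
abbrev Interior (d R : ℕ) : Type := { v : TreeVertex d R // v.depth < R }

end TreeVertex

open TreeVertex

/-- The Dirichlet Laplacian `𝓛_D` of the finite `d`-regular tree of depth `L+1`:
the normalized Laplacian (every interior vertex has degree `d`) restricted to the rows
and columns of the interior vertices, i.e. with the leaves (depth `L+1`) deleted:
diagonal entries `1` and entry `−1/d` between adjacent interior vertices. -/
noncomputable def dirichletLaplacian (d L : ℕ) :
    Matrix (Interior d (L + 1)) (Interior d (L + 1)) ℝ := fun u v =>
  if u = v then 1 else if Adj u.1 v.1 then -(1 / (d : ℝ)) else 0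

namespace TreeVertex

variable {d R : ℕ}

theorem not_adj_self (v : TreeVertex d R) : ¬ Adj v v := by
  rintro (h | h) <;> exact absurd h.1 (by omega)

/-- The children of `v` are parametrised by the step leading to them. -/
theorem sum_children (v : TreeVertex d R) (hv : v.depth < R) (F : TreeVertex d R → ℝ)
    (G : Fin d → ℝ) (hFG : ∀ u, ChildOf v u → F u = G (u.1.2 ⟨v.depth, hv⟩)) :
    ∑ u with ChildOf v u, F u =
      ∑ c ∈ Finset.univ.filter fun c : Fin d => 0 < v.depth → (c : ℕ) < d - 1, G c := by
  refine Finset.sum_bij (fun u _ => u.1.2 ⟨v.depth, hv⟩) ?_ ?_ ?_ ?_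
  · intro u hu
    simp only [Finset.mem_filter, Finset.mem_univ, true_and] at hu ⊢
    intro h
    refine u.2.2 _ h ?_
    have := hu.1
    simp only [depth] at this ⊢
    omega
  · intro u hu w hw huw
    simp only [Finset.mem_filter, Finset.mem_univ, true_and] at hu hw
    have hdep : u.1.1.1 = w.1.1.1 := hu.1.trans hw.1.symm
    refine Subtype.ext (Prod.ext (Fin.ext hdep) (funext fun i => ?_))
    rcases lt_trichotomy i.1 v.depth with h | h | h
    · rw [hu.2 i h, hw.2 i h]
    · have hi : i = ⟨v.depth, hv⟩ := Fin.ext h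
      rw [hi]
      exact huw
    · have hu1 : u.1.1.1 = v.depth + 1 := hu.1
      exact Fin.ext ((u.2.1 i (by omega)).trans (w.2.1 i (by omega)).symm)
  · intro c hc
    simp only [Finset.mem_filter, Finset.mem_univ, true_and] at hc
    refine ⟨⟨(⟨v.depth + 1, by omega⟩, Function.update v.1.2 ⟨v.depth, hv⟩ c), ?_, ?_⟩, ?_, ?_⟩
    · intro i hi
      have hi' : v.depth + 1 ≤ i.1 := hi
      have hne : i ≠ ⟨v.depth, hv⟩ := fun h => by simp [h] at hi'
      simp only [Function.update_of_ne hne]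
      refine v.2.1 i ?_
      simp only [depth] at hi'
      omega
    · intro i hi0 hi
      have hi' : i.1 < v.depth + 1 := hi
      by_cases hne : i = ⟨v.depth, hv⟩
      · subst hne
        simpa using hc hi0
      · simp only [Function.update_of_ne hne]
        refine v.2.2 i hi0 ?_
        have : i.1 ≠ v.depth := fun h => hne (Fin.ext h)
        simp only [depth] at hi' this
        omega
    · simp only [Finset.mem_filter, Finset.mem_univ, true_and]
      refine ⟨rfl, fun i hi => ?_⟩
      exact Function.update_of_ne (fun h => by simp [h] at hi) _ _
    · simp
  · intro u hu
    exact hFG u (by simpa using hu)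

/-- A vertex other than the root has exactly one parent. -/
theorem sum_parents (v : TreeVertex d R) (hv : 0 < v.depth) (F : TreeVertex d R → ℝ) (K : ℝ)
    (hF : ∀ u, ChildOf u v → F u = K) : ∑ u with ChildOf u v, F u = K := by
  have hR : v.depth < R + 1 := v.1.1.2
  let p : TreeVertex d R :=
    ⟨(⟨v.depth - 1, by omega⟩,
      fun i => if i.1 < v.depth - 1 then v.1.2 i else ⟨0, (v.1.2 i).pos⟩), by
        intro i hi
        have hi' : ¬ i.1 < v.depth - 1 := not_lt.2 hi
        simp only [hi', if_false], by
        intro i hi0 hi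
        have hi' : i.1 < v.depth - 1 := hi
        simp only [hi', if_true]
        exact v.2.2 i hi0 (lt_of_lt_of_le hi' (Nat.sub_le _ _))⟩
  have hp : ChildOf p v := by
    refine ⟨?_, fun i hi => ?_⟩
    · change v.depth = v.depth - 1 + 1
      omega
    · have hi' : i.1 < v.depth - 1 := hi
      simp [p, hi']
  have huniq : ∀ u, ChildOf u v → u = p := by
    intro u hu
    have h1 := hu.1
    have h2 : u.1.1.1 = v.depth - 1 := by
      change u.depth = _
      omega
    refine Subtype.ext (Prod.ext (Fin.ext h2) (funext fun i => ?_))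
    by_cases hi : i.1 < v.depth - 1
    · simp only [p, hi, if_true]
      exact (hu.2 i (by omega)).symm
    · simp only [p, hi, if_false]
      exact Fin.ext (u.2.1 i (by omega))
  have : (Finset.univ.filter fun u => ChildOf u v) = {p} := by
    ext u
    simp only [Finset.mem_filter, Finset.mem_univ, true_and, Finset.mem_singleton]
    exact ⟨huniq u, fun h => h ▸ hp⟩
  rw [this, Finset.sum_singleton, hF p hp]

theorem sum_adj_eq (v : TreeVertex d R) (F : TreeVertex d R → ℝ) :
    (∑ u, if Adj v u then F u else 0) =
      ∑ u with ChildOf v u, F u + ∑ u with ChildOf u v, F u := by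
  rw [Finset.sum_filter, Finset.sum_filter, ← Finset.sum_add_distrib]
  refine Finset.sum_congr rfl fun u _ => ?_
  by_cases h1 : ChildOf v u <;> by_cases h2 : ChildOf u v <;> simp [Adj, h1, h2]
  exact absurd h1.1 (by have := h2.1; omega)

/-- Neighbour sum at the root of a function of the first step and the depth. -/
theorem sum_adj_of_depth_eq_zero {L : ℕ} (e : Fin d → ℝ) (g : ℕ → ℝ)
    (v : TreeVertex d (L + 1)) (hv : v.depth = 0) :
    (∑ u : TreeVertex d (L + 1), if Adj v u then e (u.1.2 0) * g u.depth else 0) =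
      (∑ c, e c) * g 1 := by
  rw [sum_adj_eq, sum_children v (by omega) _ (fun c => e c * g 1)]
  · have : (Finset.univ.filter fun u => ChildOf u v) = ∅ := by
      refine Finset.filter_eq_empty_iff.2 fun u _ h => ?_
      have := h.1
      omega
    rw [this]
    simp [hv, Finset.sum_mul]
  · intro u hu
    have h0 : (⟨v.depth, by omega⟩ : Fin (L + 1)) = 0 := Fin.ext hv
    rw [h0, hu.1, hv]

theorem card_filter_lt_pred (hd : 0 < d) :
    (Finset.univ.filter fun c : Fin d => (c : ℕ) < d - 1).card = d - 1 := by
  obtain ⟨n, rfl⟩ : ∃ n, d = n + 1 := ⟨d - 1, by omega⟩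
  simp [Fin.card_filter_val_lt]

/-- Neighbour sum at a vertex of positive depth of a function of the first step and the depth. -/
theorem sum_adj_of_depth_eq_succ {L n : ℕ} (hd : 0 < d) (e : Fin d → ℝ) (g : ℕ → ℝ)
    (he : ∀ c c', e c * g 0 = e c' * g 0)
    (v : TreeVertex d (L + 1)) (hv : v.depth = n + 1) (hvL : v.depth < L + 1) :
    (∑ u : TreeVertex d (L + 1), if Adj v u then e (u.1.2 0) * g u.depth else 0) =
      e (v.1.2 0) * (((d : ℝ) - 1) * g (n + 2) + g n) := by
  rw [sum_adj_eq, sum_children v hvL _ (fun _ => e (v.1.2 0) * g (n + 2)),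
    sum_parents v (by omega) _ (e (v.1.2 0) * g n)]
  · have h0 : 0 < v.depth := by omega
    simp only [h0, true_imp_iff, Finset.sum_const, card_filter_lt_pred hd, nsmul_eq_mul]
    rw [Nat.cast_sub hd]
    push_cast
    ring
  · intro u hu
    have h1 : u.depth = n := by have := hu.1; omega
    rw [h1]
    rcases Nat.eq_zero_or_pos n with rfl | hn
    · exact he _ _
    · rw [hu.2 0 (by simp [h1, hn])]
  · intro u hu
    rw [hu.2 0 (by simp [hv]), hu.1, hv]

end TreeVertex

theorem dirichletLaplacian_mulVec_apply {d L : ℕ} (x : Interior d (L + 1) → ℝ)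
    (v : Interior d (L + 1)) :
    (dirichletLaplacian d L).mulVec x v =
      x v - 1 / (d : ℝ) * ∑ u : Interior d (L + 1), if Adj v.1 u.1 then x u else 0 := by
  have hterm : ∀ u, dirichletLaplacian d L v u * x u =
      (if v = u then x u else 0) - 1 / (d : ℝ) * (if Adj v.1 u.1 then x u else 0) := by
    intro u
    by_cases h : v = u
    · subst h
      simp [dirichletLaplacian, not_adj_self]
    · by_cases h' : Adj v.1 u.1 <;> simp [dirichletLaplacian, h, h']
  simp only [Matrix.mulVec, dotProduct, hterm, Finset.sum_sub_distrib, ← Finset.mul_sum]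
  simp

theorem mul_inv_pow_succ {r : ℝ} (hr : r ≠ 0) (n : ℕ) : r * r⁻¹ ^ (n + 1) = r⁻¹ ^ n := by
  rw [pow_succ, mul_left_comm, mul_inv_cancel₀ hr, mul_one]

theorem sq_mul_inv_pow_add_two {r : ℝ} (hr : r ≠ 0) (n : ℕ) :
    r ^ 2 * r⁻¹ ^ (n + 2) = r⁻¹ ^ n := by
  rw [pow_add, mul_left_comm, ← mul_pow, mul_inv_cancel₀ hr, one_pow, mul_one]

/-- The function `(d-1)^(-n/2)` of the depth `n` is a positive supersolution. -/
theorem sum_adj_inv_sqrt_pow_le {d L : ℕ} (hd : 3 ≤ d) (v : Interior d (L + 1)) :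
    (∑ u : Interior d (L + 1),
        if Adj v.1 u.1 then (Real.sqrt ((d : ℝ) - 1))⁻¹ ^ u.1.depth else 0) ≤
      2 * Real.sqrt ((d : ℝ) - 1) * (Real.sqrt ((d : ℝ) - 1))⁻¹ ^ v.1.depth := by
  have hd' : (3 : ℝ) ≤ d := by exact_mod_cast hd
  have hsq : Real.sqrt ((d : ℝ) - 1) ^ 2 = (d : ℝ) - 1 := Real.sq_sqrt (by linarith)
  have hr : 0 < Real.sqrt ((d : ℝ) - 1) := Real.sqrt_pos.2 (by linarith)
  set r := Real.sqrt ((d : ℝ) - 1)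
  have hle : (∑ u : Interior d (L + 1), if Adj v.1 u.1 then r⁻¹ ^ u.1.depth else 0) ≤
      ∑ u : TreeVertex d (L + 1), if Adj v.1 u then (1 : ℝ) * r⁻¹ ^ u.depth else 0 := by
    rw [← Fintype.sum_subtype_add_sum_subtype (fun u : TreeVertex d (L + 1) => u.depth < L + 1)]
    simp only [one_mul]
    refine le_add_of_nonneg_right (Finset.sum_nonneg fun u _ => ?_)
    split_ifs <;> positivity
  refine hle.trans ?_
  rcases hn : v.1.depth with _ | n
  · rw [sum_adj_of_depth_eq_zero (fun _ => 1) (fun n => r⁻¹ ^ n) v.1 hn]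
    simp only [Finset.sum_const, Finset.card_univ, Fintype.card_fin, nsmul_eq_mul, mul_one,
      pow_one, pow_zero]
    rw [← div_eq_mul_inv, div_le_iff₀ hr]
    nlinarith
  · rw [sum_adj_of_depth_eq_succ (by omega) (fun _ => 1) (fun n => r⁻¹ ^ n) (fun _ _ => rfl)
      v.1 hn v.2, ← hsq]
    refine le_of_eq ?_
    linear_combination sq_mul_inv_pow_add_two hr.ne' n - 2 * mul_inv_pow_succ hr.ne' n

theorem le_of_dirichletLaplacian_mulVec_eq {d L : ℕ} (hd : 3 ≤ d) {lam : ℝ}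
    {x : Interior d (L + 1) → ℝ} (hx : x ≠ 0)
    (hlam : (dirichletLaplacian d L).mulVec x = lam • x) :
    1 - 2 / (d : ℝ) * Real.sqrt ((d : ℝ) - 1) ≤ lam := by
  have hd' : (3 : ℝ) ≤ d := by exact_mod_cast hd
  have hsum := sum_adj_inv_sqrt_pow_le (L := L) hd
  have hr : 0 < Real.sqrt ((d : ℝ) - 1) := Real.sqrt_pos.2 (by linarith)
  set r := Real.sqrt ((d : ℝ) - 1)
  have hs : ∀ n : ℕ, 0 < r⁻¹ ^ n := fun n => by positivity
  obtain ⟨w, hw⟩ := Function.ne_iff.1 hx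
  have : Nonempty (Interior d (L + 1)) := ⟨w⟩
  obtain ⟨v, hv⟩ := Finite.exists_max fun u : Interior d (L + 1) => |x u| / r⁻¹ ^ u.1.depth
  set M := |x v| / r⁻¹ ^ v.1.depth with hM
  have hxv : |x v| = M * r⁻¹ ^ v.1.depth := by
    rw [hM, div_mul_cancel₀ _ (hs _).ne']
  have hMpos : 0 < M := lt_of_lt_of_le (div_pos (abs_pos.2 hw) (hs _)) (hv w)
  have hxle : ∀ u, |x u| ≤ M * r⁻¹ ^ u.1.depth := fun u => (div_le_iff₀ (hs _)).1 (hv u)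
  have heq := congrFun hlam v
  rw [dirichletLaplacian_mulVec_apply, Pi.smul_apply, smul_eq_mul] at heq
  have hbound : |∑ u : Interior d (L + 1), if Adj v.1 u.1 then x u else 0| ≤
      2 * r * |x v| := by
    calc _ ≤ ∑ u : Interior d (L + 1), |if Adj v.1 u.1 then x u else 0| :=
          Finset.abs_sum_le_sum_abs _ _
      _ ≤ ∑ u : Interior d (L + 1), M * (if Adj v.1 u.1 then r⁻¹ ^ u.1.depth else 0) := by
          refine Finset.sum_le_sum fun u _ => ?_
          split_ifs
          · exact hxle u
          · simp
      _ = M * ∑ u : Interior d (L + 1), (if Adj v.1 u.1 then r⁻¹ ^ u.1.depth else 0) := by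
          rw [Finset.mul_sum]
      _ ≤ M * (2 * r * r⁻¹ ^ v.1.depth) := mul_le_mul_of_nonneg_left (hsum v) hMpos.le
      _ = 2 * r * |x v| := by rw [hxv]; ring
  have hxpos : 0 < |x v| := by rw [hxv]; exact mul_pos hMpos (hs _)
  have hmul : (∑ u : Interior d (L + 1), if Adj v.1 u.1 then x u else 0) =
      (d * (1 - lam)) * x v := by
    field_simp at heq
    linarith
  rw [hmul, abs_mul] at hbound
  have h1 := (le_abs_self _).trans (le_of_mul_le_mul_right hbound hxpos)
  have h2 : 1 - lam ≤ 2 * r / d := by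
    rw [le_div_iff₀ (by linarith)]
    linarith
  have h3 : 2 / (d : ℝ) * r = 2 * r / d := by ring
  linarith

theorem sum_sign_eq_zero {d : ℕ} (hd : 2 ≤ d) :
    ∑ c : Fin d, (if (c : ℕ) = 0 then (1 : ℝ) else if (c : ℕ) = 1 then -1 else 0) = 0 := by
  obtain ⟨n, rfl⟩ : ∃ n, d = n + 2 := ⟨d - 2, by omega⟩
  simp [Fin.sum_univ_succ]

theorem sin_recurrence (θ : ℝ) (n : ℕ) :
    Real.sin ((n + 2 : ℕ) * θ) + Real.sin (n * θ) =
      2 * Real.cos θ * Real.sin ((n + 1 : ℕ) * θ) := by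
  have h1 : ((n + 2 : ℕ) : ℝ) * θ = (n + 1 : ℕ) * θ + θ := by push_cast; ring
  have h2 : (n : ℝ) * θ = (n + 1 : ℕ) * θ - θ := by push_cast; ring
  rw [h1, h2, Real.sin_add, Real.sin_sub]
  ring

/-- An explicit eigenvector, antisymmetric with respect to two branches at the root. -/
theorem exists_dirichletLaplacian_eigenvector {d L : ℕ} (hd : 3 ≤ d) (hL : 1 ≤ L) :
    ∃ x : Interior d (L + 1) → ℝ, x ≠ 0 ∧ (dirichletLaplacian d L).mulVec x =
      (1 - 2 / (d : ℝ) * Real.sqrt ((d : ℝ) - 1) * Real.cos (Real.pi / (L + 1 : ℕ))) • x := by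
  have hd' : (3 : ℝ) ≤ d := by exact_mod_cast hd
  have hsq : Real.sqrt ((d : ℝ) - 1) ^ 2 = (d : ℝ) - 1 := Real.sq_sqrt (by linarith)
  have hr : 0 < Real.sqrt ((d : ℝ) - 1) := Real.sqrt_pos.2 (by linarith)
  set r := Real.sqrt ((d : ℝ) - 1)
  set θ := Real.pi / (L + 1 : ℕ) with hθ
  let e : Fin d → ℝ := fun c => if (c : ℕ) = 0 then 1 else if (c : ℕ) = 1 then -1 else 0
  let g : ℕ → ℝ := fun n => r⁻¹ ^ n * Real.sin (n * θ)
  have hg0 : g 0 = 0 := by simp [g]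
  have hgL : g (L + 1) = 0 := by
    have : ((L + 1 : ℕ) : ℝ) * θ = Real.pi := by rw [hθ]; field_simp
    simp only [g, this, Real.sin_pi, mul_zero]
  have hgrec : ∀ n, ((d : ℝ) - 1) * g (n + 2) + g n = 2 * r * Real.cos θ * g (n + 1) := by
    intro n
    have h := sin_recurrence θ n
    simp only [g, ← hsq]
    linear_combination r⁻¹ ^ n * h + Real.sin ((n + 2 : ℕ) * θ) * sq_mul_inv_pow_add_two hr.ne' n -
      2 * Real.cos θ * Real.sin ((n + 1 : ℕ) * θ) * mul_inv_pow_succ hr.ne' n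
  refine ⟨fun u => e (u.1.1.2 0) * g u.1.depth, ?_, ?_⟩
  · let w : Interior d (L + 1) :=
      ⟨⟨(⟨1, by omega⟩, fun _ => ⟨0, by omega⟩), fun _ _ => rfl, fun _ _ _ => by
        change 0 < d - 1
        omega⟩, by
        change 1 < L + 1
        omega⟩
    refine Function.ne_iff.2 ⟨w, ?_⟩
    have hw : e (w.1.1.2 0) * g w.1.depth = r⁻¹ * Real.sin θ := by
      simp [w, e, g, depth]
    have hθpos : 0 < θ := by positivity
    have hθlt : θ < Real.pi := by
      refine div_lt_self Real.pi_pos ?_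
      exact_mod_cast (by omega : 1 < L + 1)
    simp only [hw, Pi.zero_apply]
    exact (mul_pos (inv_pos.2 hr) (Real.sin_pos_of_pos_of_lt_pi hθpos hθlt)).ne'
  · funext v
    rw [dirichletLaplacian_mulVec_apply]
    have hext : (∑ u : Interior d (L + 1),
          if Adj v.1 u.1 then e (u.1.1.2 0) * g u.1.depth else 0) =
        ∑ u : TreeVertex d (L + 1), if Adj v.1 u then e (u.1.2 0) * g u.depth else 0 := by
      rw [← Fintype.sum_subtype_add_sum_subtype
        (fun u : TreeVertex d (L + 1) => u.depth < L + 1)]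
      refine (add_eq_left.2 (Finset.sum_eq_zero fun u _ => ?_)).symm
      have h1 : u.1.depth < L + 1 + 1 := u.1.1.1.2
      have h2 : u.1.depth = L + 1 := by have := u.2; omega
      simp [h2, hgL]
    have hsum : (∑ u : TreeVertex d (L + 1),
          if Adj v.1 u then e (u.1.2 0) * g u.depth else 0) =
        2 * r * Real.cos θ * (e (v.1.1.2 0) * g v.1.depth) := by
      rcases hn : v.1.depth with _ | n
      · rw [sum_adj_of_depth_eq_zero e g v.1 hn, hg0, sum_sign_eq_zero (by omega)]
        ring
      · rw [sum_adj_of_depth_eq_succ (by omega) e g (by simp [hg0]) v.1 hn v.2, hgrec]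
        ring
    rw [hext, hsum, Pi.smul_apply, smul_eq_mul]
    ring

/-- For integers `d ≥ 3` and `L ≥ 0`, the smallest eigenvalue of the
Dirichlet Laplacian `𝓛_D` of the finite `d`-regular tree of depth `L+1` converges, as
`L → ∞`, to `1 − (2/d)·√(d−1)`, the spectral gap of the infinite `d`-regular tree. -/
theorem dirichlet_spectral_gap_tendsto_infinite_tree_gap (d : ℕ) (hd : 3 ≤ d) :
    Filter.Tendsto
      (fun L : ℕ => sInf {lam : ℝ |
        ∃ x : Interior d (L + 1) → ℝ, x ≠ 0 ∧ (dirichletLaplacian d L).mulVec x = lam • x})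
      Filter.atTop
      (nhds (1 - (2 / (d : ℝ)) * Real.sqrt ((d : ℝ) - 1))) := by
  have hcos : Filter.Tendsto (fun L : ℕ => Real.cos (Real.pi / (L + 1 : ℕ)))
      Filter.atTop (nhds 1) := by
    have h : Filter.Tendsto (fun L : ℕ => Real.pi / ((L + 1 : ℕ) : ℝ)) Filter.atTop (nhds 0) :=
      (tendsto_const_div_atTop_nhds_zero_nat Real.pi).comp (Filter.tendsto_add_atTop_nat 1)
    simpa [Function.comp_def] using (Real.continuous_cos.tendsto 0).comp h
  have hupper := (hcos.const_mul (2 / (d : ℝ) * Real.sqrt ((d : ℝ) - 1))).const_sub 1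
  rw [mul_one] at hupper
  refine tendsto_of_tendsto_of_tendsto_of_le_of_le' tendsto_const_nhds hupper ?_ ?_
  · filter_upwards [Filter.eventually_ge_atTop 1] with L hL
    refine le_csInf ⟨_, exists_dirichletLaplacian_eigenvector hd hL⟩ ?_
    rintro lam ⟨x, hx, hlam⟩
    exact le_of_dirichletLaplacian_mulVec_eq hd hx hlam
  · filter_upwards [Filter.eventually_ge_atTop 1] with L hL
    refine csInf_le ⟨1 - 2 / (d : ℝ) * Real.sqrt ((d : ℝ) - 1), ?_⟩
      (exists_dirichletLaplacian_eigenvector hd hL)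
    rintro lam ⟨x, hx, hlam⟩
    exact le_of_dirichletLaplacian_mulVec_eq hd hx hlam
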